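/- Let R be a Noetherian ring, 𝔞 an ideal, and M a nonzero R-module (not necessarily finitely generated) with d := dim M = dim R finite. Then Att_R(H^d_𝔞(M)) ⊆ { 𝔭 ∈ Ass_R(M) : cd(𝔞, R/𝔭) = d }. -/

import Mathlib

open CategoryTheory

/-- `HasCD a M c` : the cohomological dimension of `M` with respect to `a` is `c`,
i.e. `H^c_a(M) ≠ 0` and `H^i_a(M) = 0` for all `i > c`. -/
def HasCD {R : Type} [CommRing R] (a : Ideal R) (M : ModuleCat R) (c : ℕ) : Prop :=
  Nontrivial ((localCohomology a c).obj M) ∧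
    ∀ i, c < i → Subsingleton ((localCohomology a i).obj M)

/-- The attached primes of an `R`-module `A`: primes of the form `Ann_R(A/B)`. -/
def attachedPrimes (R : Type) [CommRing R] (A : Type) [AddCommGroup A] [Module R A] :
    Set (Ideal R) :=
  {p | p.IsPrime ∧ ∃ B : Submodule R A, p = Module.annihilator R (A ⧸ B)}

section
open CategoryTheory Limits Opposite

namespace LC
noncomputable section

variable {R : Type} [CommRing R]

abbrev GY (Y : ModuleCat.{0} R) : ModuleCat.{0} R ⥤ (ModuleCat.{0} R)ᵒᵖ :=
  ((linearYoneda R (ModuleCat.{0} R)).obj Y).rightOp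

abbrev KY {X : ModuleCat.{0} R} (P : ProjectiveResolution X) (Y : ModuleCat.{0} R) :
    ChainComplex (ModuleCat.{0} R)ᵒᵖ ℕ :=
  ((GY Y).mapHomologicalComplex _).obj P.complex

abbrev OE (X Y : ModuleCat.{0} R) (n : ℕ) : ModuleCat.{0} R :=
  unop (((GY Y).leftDerived n).obj X)

variable {X X' Y Y' : ModuleCat.{0} R} (P : ProjectiveResolution X)
  (P' : ProjectiveResolution X') (n : ℕ)

def isoD (P : ProjectiveResolution X) (Y : ModuleCat.{0} R) (n : ℕ) :
    ((GY Y).leftDerived n).obj X ≅ (KY P Y).homology n :=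
  P.isoLeftDerivedObj (GY Y) n

lemma isoD_nat_X (g : X' ⟶ X) (φ : ProjectiveResolution.Hom P' P g) :
    ((GY Y).leftDerived n).map g ≫ (isoD P Y n).hom = (isoD P' Y n).hom ≫
      HomologicalComplex.homologyMap (((GY Y).mapHomologicalComplex _).map φ.hom) n :=
  ProjectiveResolution.isoLeftDerivedObj_hom_naturality g P' P φ.hom
    (φ.hom_f_zero_comp_π_f_zero) (GY Y) n

lemma isoD_nat_Y (α : GY Y' ⟶ GY Y) :
    (NatTrans.leftDerived α n).app X = (isoD P Y' n).hom ≫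
      HomologicalComplex.homologyMap (K := KY P Y') (L := KY P Y) ((NatTrans.mapHomologicalComplex α _).app P.complex) n ≫
      (isoD P Y n).inv :=
  ProjectiveResolution.leftDerived_app_eq α P n

def rho {X : ModuleCat.{0} R} (P : ProjectiveResolution X) (Y : ModuleCat.{0} R) (n : ℕ) :
    ((KY P Y).opcycles n).unop ⟶ OE X Y n :=
  ((isoD P Y n).hom ≫ (KY P Y).homologyι n).unop

def inc {X : ModuleCat.{0} R} (P : ProjectiveResolution X) (Y : ModuleCat.{0} R) (n : ℕ) :
    ((KY P Y).opcycles n).unop ⟶ ModuleCat.of R (P.complex.X n ⟶ Y) :=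
  ((KY P Y).pOpcycles n).unop

lemma rho_surj : Function.Surjective (rho P Y n) := by
  rw [← ModuleCat.epi_iff_surjective]
  have : Mono ((isoD P Y n).hom ≫ (KY P Y).homologyι n) := inferInstance
  exact unop_epi_of_mono _

lemma inc_inj : Function.Injective (inc P Y n) := by
  rw [← ModuleCat.mono_iff_injective]
  have : Epi ((KY P Y).pOpcycles n) := inferInstance
  exact unop_mono_of_epi _

def dcomp (i j : ℕ) : ModuleCat.of R (P.complex.X j ⟶ Y) ⟶ ModuleCat.of R (P.complex.X i ⟶ Y) :=
  ((KY P Y).d i j).unop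

lemma dcomp_apply (i j : ℕ) (f : P.complex.X j ⟶ Y) : dcomp P i j f = P.complex.d i j ≫ f := rfl

lemma inc_range (f : P.complex.X n ⟶ Y) :
   (∃ z, inc P Y n z = f) ↔ P.complex.d (n+1) n ≫ f = 0 := by
  have h := (KY P Y).d_pOpcycles (n+1) n
  have hex : (ShortComplex.mk _ _ h).Exact := ShortComplex.exact_of_g_is_cokernel _
    ((KY P Y).opcyclesIsCokernel (n+1) n (by simp))
  have := hex.unop
  rw [ShortComplex.moduleCat_exact_iff] at this
  constructor
  · rintro ⟨z, rfl⟩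
    have h2 : inc P Y n ≫ dcomp P (n+1) n = 0 := by
      apply Quiver.Hom.op_inj; exact h
    exact ConcreteCategory.congr_hom h2 z
  · intro hf
    exact this f hf

lemma rho_zero (z) :
   rho P Y n z = 0 ↔ ∃ g : P.complex.X ((ComplexShape.down ℕ).next n) ⟶ Y,
     P.complex.d n _ ≫ g = inc P Y n z := by
  have h := (KY P Y).homologyι_comp_fromOpcycles n ((ComplexShape.down ℕ).next n)
  have hex : (ShortComplex.mk _ _ h).Exact := ShortComplex.exact_of_f_is_kernel _
    ((KY P Y).homologyIsKernel n _ rfl)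
  have := hex.unop
  rw [ShortComplex.moduleCat_exact_iff] at this
  have e1 : ((KY P Y).fromOpcycles n ((ComplexShape.down ℕ).next n)).unop ≫ inc P Y n = 
    dcomp P n ((ComplexShape.down ℕ).next n) := by
      apply Quiver.Hom.op_inj; exact (KY P Y).p_fromOpcycles _ _
  have e2 : rho P Y n = ((KY P Y).homologyι n).unop ≫ (isoD P Y n).hom.unop := rfl
  have e3 : ((KY P Y).fromOpcycles n ((ComplexShape.down ℕ).next n)).unop ≫ rho P Y n = 0 := by
    rw [e2, ← Category.assoc, ← unop_comp, h]; simp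
  constructor
  · intro hz
    have hz' : ((KY P Y).homologyι n).unop z = 0 := by
      have : Function.Injective ((isoD P Y n).hom.unop) := by
        rw [← ModuleCat.mono_iff_injective]; infer_instance
      apply this
      rw [map_zero]
      exact hz
    obtain ⟨g, hg⟩ := this z hz'
    refine ⟨g, ?_⟩
    refine (ConcreteCategory.congr_hom e1 g).symm.trans ?_
    exact congr_arg (inc P Y n) hg
  · rintro ⟨g, hg⟩
    have : ((KY P Y).fromOpcycles n ((ComplexShape.down ℕ).next n)).unop g = z := by
      apply inc_inj
      exact (ConcreteCategory.congr_hom e1 g).trans hg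
    rw [← this]
    exact ConcreteCategory.congr_hom e3 g

/-- naturality in `Y`. -/
lemma rep_nat_Y (g : Y ⟶ Y') (z) : ∃ z', rho P Y' n z' = ((Ext R (ModuleCat.{0} R) n).obj (op X)).map g (rho P Y n z)
    ∧ inc P Y' n z' = (inc P Y n z : P.complex.X n ⟶ Y) ≫ g := by
  let α : GY Y' ⟶ GY Y := NatTrans.rightOp ((linearYoneda R (ModuleCat.{0} R)).map g)
  let φ : KY P Y' ⟶ KY P Y := (NatTrans.mapHomologicalComplex α _).app P.complex
  refine ⟨(HomologicalComplex.opcyclesMap φ n).unop z, ?_, ?_⟩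
  · have e1 : ((Ext R (ModuleCat.{0} R) n).obj (op X)).map g = ((NatTrans.leftDerived α n).app X).unop := rfl
    have e2 : (HomologicalComplex.opcyclesMap φ n).unop ≫ rho P Y' n = rho P Y n ≫ ((NatTrans.leftDerived α n).app X).unop := by
      apply Quiver.Hom.op_inj
      change ((isoD P Y' n).hom ≫ (KY P Y').homologyι n) ≫ HomologicalComplex.opcyclesMap φ n = 
        (NatTrans.leftDerived α n).app X ≫ ((isoD P Y n).hom ≫ (KY P Y).homologyι n)
      rw [Category.assoc, ← HomologicalComplex.homologyι_naturality, 
        isoD_nat_Y P n α]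
      simp only [Category.assoc, Iso.inv_hom_id_assoc]
      rfl
    exact ConcreteCategory.congr_hom e2 z
  · have e2 := congr_arg Quiver.Hom.unop (HomologicalComplex.p_opcyclesMap φ n)
    exact ConcreteCategory.congr_hom e2 z

/-- naturality in `X`. -/
lemma rep_nat_X (g : X' ⟶ X) (φ : ProjectiveResolution.Hom P' P g) (z) : ∃ z', rho P' Y n z' = ((Ext R (ModuleCat.{0} R) n).map g.op).app Y (rho P Y n z)
    ∧ inc P' Y n z' = φ.hom.f n ≫ (inc P Y n z : P.complex.X n ⟶ Y) := by
  let ψ : KY P' Y ⟶ KY P Y := ((GY Y).mapHomologicalComplex _).map φ.hom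
  refine ⟨(HomologicalComplex.opcyclesMap ψ n).unop z, ?_, ?_⟩
  · have e2 : (HomologicalComplex.opcyclesMap ψ n).unop ≫ rho P' Y n = rho P Y n ≫ (((GY Y).leftDerived n).map g).unop := by
      apply Quiver.Hom.op_inj
      change ((isoD P' Y n).hom ≫ (KY P' Y).homologyι n) ≫ HomologicalComplex.opcyclesMap ψ n = 
        ((GY Y).leftDerived n).map g ≫ ((isoD P Y n).hom ≫ (KY P Y).homologyι n)
      rw [Category.assoc, ← HomologicalComplex.homologyι_naturality]
      rw [← Category.assoc (((GY Y).leftDerived n).map g), isoD_nat_X P P' n g φ, Category.assoc]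
    exact ConcreteCategory.congr_hom e2 z
  · have e2 := congr_arg Quiver.Hom.unop (HomologicalComplex.p_opcyclesMap ψ n)
    exact ConcreteCategory.congr_hom e2 z

open Abelian in
lemma extMk_zero_iff (f : P.complex.X n ⟶ Y) (hf : P.complex.d (n+1) n ≫ f = 0) :
    P.extMk f (n+1) rfl hf = 0 ↔ ∃ g : P.complex.X ((ComplexShape.down ℕ).next n) ⟶ Y,
      P.complex.d n _ ≫ g = f := by
  cases n with
  | succ n =>
    have : (ComplexShape.down ℕ).next (n+1) = n := by simp
    rw [this]
    exact P.extMk_eq_zero_iff f _ rfl hf n rfl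
  | zero =>
    have : (ComplexShape.down ℕ).next 0 = 0 := by simp
    rw [this]
    have h0 : P.complex.d 0 0 = 0 := P.complex.shape _ _ (by simp)
    simp only [h0, zero_comp, exists_const]
    constructor
    · intro h
      simp only [← P.extEquivCohomologyClass.apply_eq_iff_eq,
        ProjectiveResolution.extEquivCohomologyClass_extMk,
        ProjectiveResolution.extEquivCohomologyClass_zero,
        CochainComplex.HomComplex.CohomologyClass.mk_eq_zero_iff] at h
      rw [CochainComplex.HomComplex.Cocycle.toSingleMk_mem_coboundaries_iff _ _ _ _ _ 1 (by lia)] at h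
      obtain ⟨g, hg⟩ := h
      have hz : IsZero (P.cochainComplex.X 1) := P.cochainComplex.isZero_of_isStrictlyLE 0 1 (by simp)
      rw [hz.eq_of_src g 0, comp_zero] at hg
      rw [← cancel_epi (P.cochainComplexXIso _ 0 rfl).hom, comp_zero]
      exact hg
    · rintro rfl
      exact P.extMk_zero _ rfl

def sig (P : ProjectiveResolution X) (Y : ModuleCat.{0} R) (n : ℕ) :
    ((KY P Y).opcycles n).unop →ₗ[R] Abelian.Ext X Y n where
  toFun z := P.extMk (inc P Y n z) (n+1) rfl ((inc_range P n _).1 ⟨z, rfl⟩)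
  map_add' z w := by
    rw [P.add_extMk]; congr 1; exact map_add (inc P Y n).hom z w
  map_smul' r z := by
    rw [RingHom.id_apply, Abelian.Ext.smul_eq_comp_mk₀, P.extMk_comp_mk₀]
    congr 1
    rw [Linear.comp_smul, Category.comp_id]
    exact map_smul (inc P Y n).hom r z

lemma sig_surj : Function.Surjective (sig P Y n) := by
  intro α
  obtain ⟨f, hf, rfl⟩ := P.extMk_surjective α (n+1) rfl
  obtain ⟨z, hz⟩ := (inc_range P n f).2 hf
  refine ⟨z, ?_⟩
  subst hz
  rfl

lemma sig_ker : LinearMap.ker (sig P Y n) = LinearMap.ker (rho P Y n).hom := by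
  ext z
  rw [LinearMap.mem_ker, LinearMap.mem_ker]
  exact (extMk_zero_iff P n _ ((inc_range P n _).1 ⟨z, rfl⟩)).trans (rho_zero P n z).symm

def thetaP (P : ProjectiveResolution X) (Y : ModuleCat.{0} R) (n : ℕ) :
    Abelian.Ext X Y n ≃ₗ[R] OE X Y n :=
  ((sig P Y n).quotKerEquivOfSurjective (sig_surj P n)).symm ≪≫ₗ
    Submodule.quotEquivOfEq _ _ (sig_ker P n) ≪≫ₗ
    ((rho P Y n).hom.quotKerEquivOfSurjective (rho_surj P n))

lemma thetaP_sig (z) : thetaP P Y n (sig P Y n z) = rho P Y n z := by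
  have : ((sig P Y n).quotKerEquivOfSurjective (sig_surj P n)).symm (sig P Y n z) =
      Submodule.Quotient.mk z := by
    rw [LinearEquiv.symm_apply_eq]; rfl
  simp only [thetaP, LinearEquiv.trans_apply, this]
  rfl

/-- `Abelian.Ext` agrees with the derived functor version of `Ext`. -/
def theta (X Y : ModuleCat.{0} R) (n : ℕ) :
    Abelian.Ext X Y n ≃ₗ[R] ((Ext R (ModuleCat.{0} R) n).obj (op X)).obj Y :=
  thetaP (projectiveResolution X) Y n

lemma theta_nat_Y (g : Y ⟶ Y') (α : Abelian.Ext X Y n) :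
    theta X Y' n (α.comp (Abelian.Ext.mk₀ g) (add_zero n)) =
      ((Ext R (ModuleCat.{0} R) n).obj (op X)).map g (theta X Y n α) := by
  obtain ⟨z, rfl⟩ := sig_surj (projectiveResolution X) n α
  obtain ⟨z', h1, h2⟩ := rep_nat_Y (projectiveResolution X) n g z
  have : (sig (projectiveResolution X) Y n z).comp (Abelian.Ext.mk₀ g) (add_zero n) =
      sig (projectiveResolution X) Y' n z' := by
    refine (ProjectiveResolution.extMk_comp_mk₀ _ _ (n+1) rfl ((inc_range _ n _).1 ⟨z, rfl⟩) g).trans ?_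
    simp only [← h2]
    rfl
  rw [this]
  refine (thetaP_sig _ _ _).trans (h1.trans ?_)
  exact congr_arg _ (thetaP_sig (projectiveResolution X) n z).symm

lemma theta_nat_X (g : X' ⟶ X) (α : Abelian.Ext X Y n) :
    theta X' Y n ((Abelian.Ext.mk₀ g).comp α (zero_add n)) =
      ((Ext R (ModuleCat.{0} R) n).map g.op).app Y (theta X Y n α) := by
  obtain ⟨z, rfl⟩ := sig_surj (projectiveResolution X) n α
  let φ : ProjectiveResolution.Hom (projectiveResolution X') (projectiveResolution X) g :=
    { hom := ProjectiveResolution.lift g _ _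
      hom_f_zero_comp_π_f_zero := by
        rw [← HomologicalComplex.comp_f, ProjectiveResolution.lift_commutes,
          HomologicalComplex.comp_f] }
  obtain ⟨z', h1, h2⟩ := rep_nat_X (projectiveResolution X) (projectiveResolution X') n g φ z
  have : (Abelian.Ext.mk₀ g).comp (sig (projectiveResolution X) Y n z) (zero_add n) =
      sig (projectiveResolution X') Y n z' := by
    refine (ProjectiveResolution.mk₀_comp_extMk _ (n+1) rfl ((inc_range _ n _).1 ⟨z, rfl⟩) φ).trans ?_
    simp only [← h2]
    rfl
  rw [this]
  refine (thetaP_sig _ _ _).trans (h1.trans ?_)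
  exact congr_arg _ (thetaP_sig (projectiveResolution X) n z).symm

end
end LC

namespace LC
noncomputable section
variable {R : Type} [CommRing R]

/-- The module `R / a^t`. -/
abbrev Q (a : Ideal R) (t : ℕ) : ModuleCat.{0} R := ModuleCat.of R (R ⧸ a ^ t)

/-- The projection `R / a^s → R / a^t`. -/
def pr (a : Ideal R) {t s : ℕ} (h : t ≤ s) : Q a s ⟶ Q a t :=
  ModuleCat.ofHom (Submodule.mapQ _ _ LinearMap.id (Ideal.pow_le_pow_right h))

/-- Restriction along `R / a^s → R / a^t`. -/
def restr (a : Ideal R) {t s : ℕ} (h : t ≤ s) {N : ModuleCat.{0} R} {i : ℕ}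
    (e : Abelian.Ext (Q a t) N i) : Abelian.Ext (Q a s) N i :=
  (Abelian.Ext.mk₀ (pr a h)).comp e (zero_add i)

def cc (a : Ideal R) (i : ℕ) (N : ModuleCat.{0} R) :
    Cocone (localCohomology.diagram (localCohomology.idealPowersDiagram a) i ⋙
      (evaluation _ _).obj N) :=
  ((evaluation _ _).obj N).mapCocone
    (colimit.cocone (localCohomology.diagram (localCohomology.idealPowersDiagram a) i))

def ccIs (a : Ideal R) (i : ℕ) (N : ModuleCat.{0} R) : IsColimit (cc a i N) :=
  isColimitOfPreserves _ (colimit.isColimit _)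

def iota (a : Ideal R) (i : ℕ) (N : ModuleCat.{0} R) (t : ℕ) :
    Abelian.Ext (Q a t) N i →ₗ[R] (localCohomology a i).obj N :=
  ((cc a i N).ι.app (op (op t))).hom ∘ₗ (theta (Q a t) N i).toLinearMap

variable (a : Ideal R) (i : ℕ) (N : ModuleCat.{0} R)

lemma iota_surj (x : (localCohomology a i).obj N) : ∃ t e, iota a i N t e = x := by
  obtain ⟨j, y, hy⟩ := Concrete.isColimit_exists_rep _ (ccIs a i N) x
  refine ⟨j.unop.unop, (theta _ N i).symm y, ?_⟩
  rw [← hy]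
  exact congr_arg ((cc a i N).ι.app j) ((theta _ N i).apply_symm_apply y)

lemma iota_restr {t s : ℕ} (h : t ≤ s) (e : Abelian.Ext (Q a t) N i) :
    iota a i N s (restr a h e) = iota a i N t e := by
  have h1 := theta_nat_X (Y := N) i (pr a h) e
  let f : op (op t) ⟶ (op (op s) : (ℕᵒᵖ)ᵒᵖ) := (homOfLE h).op.op
  have h2 := ConcreteCategory.congr_hom ((cc a i N).w f) (theta _ N i e)
  exact (congr_arg ((cc a i N).ι.app (op (op s))) h1).trans h2

lemma iota_zero {t : ℕ} (e : Abelian.Ext (Q a t) N i) :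
    iota a i N t e = 0 ↔ ∃ (s : ℕ) (h : t ≤ s), restr a h e = 0 := by
  constructor
  · intro he
    have h0 : (cc a i N).ι.app (op (op t)) (theta (Q a t) N i e) =
       (cc a i N).ι.app (op (op t)) (theta (Q a t) N i 0) := by
      have : iota a i N t e = iota a i N t 0 := by rw [he, map_zero]
      exact this
    obtain ⟨k, f, g, h⟩ := (Concrete.isColimit_rep_eq_iff_exists _ (ccIs a i N) _ _).1 h0
    obtain rfl : f = g := Subsingleton.elim _ _
    have hle : t ≤ k.unop.unop := leOfHom f.unop.unop
    refine ⟨k.unop.unop, hle, ?_⟩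
    apply (theta _ N i).injective
    rw [map_zero]
    refine (theta_nat_X (Y := N) i (pr a hle) e).trans (h.trans ?_)
    rw [map_zero]
    exact map_zero (ModuleCat.Hom.hom _)
  · rintro ⟨s, h, hs⟩
    rw [← iota_restr a i N h, hs, map_zero]

/-- Vanishing of local cohomology in terms of `Ext`. -/
def Van : Prop := ∀ (t : ℕ) (e : Abelian.Ext (Q a t) N i),
  ∃ (s : ℕ) (h : t ≤ s), restr a h e = 0

lemma van_iff : Subsingleton ((localCohomology a i).obj N) ↔ Van a i N := by
  constructor
  · intro _ t e
    exact (iota_zero a i N e).1 (Subsingleton.elim _ _)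
  · intro h
    refine subsingleton_of_forall_eq 0 fun x => ?_
    obtain ⟨t, e, rfl⟩ := iota_surj a i N x
    exact (iota_zero a i N e).2 (h t e)

end
end LC

namespace LC
noncomputable section
variable {R : Type} [CommRing R]
variable {a : Ideal R} {i : ℕ} {N N' : ModuleCat.{0} R}

lemma restr_restr {t s u : ℕ} (h : t ≤ s) (h' : s ≤ u) (e : Abelian.Ext (Q a t) N i) :
    restr a h' (restr a h e) = restr a (h.trans h') e := by
  unfold restr
  rw [Abelian.Ext.mk₀_comp_mk₀_assoc]
  congr 2
  exact ModuleCat.hom_ext (Submodule.linearMap_qext _ rfl)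

lemma restr_comp {t s : ℕ} (h : t ≤ s) {j k : ℕ} (e : Abelian.Ext (Q a t) N i)
    (β : Abelian.Ext N N' j) (hk : i + j = k) :
    restr a h (e.comp β hk) = (restr a h e).comp β hk := by
  unfold restr
  rw [Abelian.Ext.comp_assoc _ _ _ _ _ (by lia)]

lemma restr_zero {t s : ℕ} (h : t ≤ s) : restr a h (0 : Abelian.Ext (Q a t) N i) = 0 := by
  unfold restr
  simp

lemma restr_smul {t s : ℕ} (h : t ≤ s) (r : R) (e : Abelian.Ext (Q a t) N i) :
    restr a h (r • e) = r • restr a h e := by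
  unfold restr
  rw [Abelian.Ext.comp_smul]

lemma van_mid {S : ShortComplex (ModuleCat.{0} R)} (hS : S.ShortExact)
    (h1 : Van a i S.X₁) (h3 : Van a i S.X₃) : Van a i S.X₂ := by
  intro t e
  obtain ⟨s, hs, h⟩ := h3 t (e.comp (Abelian.Ext.mk₀ S.g) (add_zero i))
  rw [restr_comp] at h
  obtain ⟨e1, he1⟩ := Abelian.Ext.covariant_sequence_exact₂ _ hS _ h
  obtain ⟨u, hu, h'⟩ := h1 s e1
  refine ⟨u, hs.trans hu, ?_⟩
  rw [← restr_restr hs hu, ← he1, restr_comp, h', Abelian.Ext.zero_comp]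

lemma van_of_retract (f : N ⟶ N') (g : N' ⟶ N) (hfg : f ≫ g = 𝟙 N) (h : Van a i N') :
    Van a i N := by
  intro t e
  obtain ⟨s, hs, h⟩ := h t (e.comp (Abelian.Ext.mk₀ f) (add_zero i))
  refine ⟨s, hs, ?_⟩
  rw [restr_comp] at h
  have := congr_arg (fun e => e.comp (Abelian.Ext.mk₀ g) (add_zero i)) h
  simpa [hfg] using this

lemma van_iso (f : N ≅ N') (h : Van a i N') : Van a i N :=
  van_of_retract f.hom f.inv f.hom_inv_id h

lemma van_of_subsingleton [Subsingleton N] : Van a i N := by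
  intro t e
  refine ⟨t, le_rfl, ?_⟩
  rw [← Abelian.Ext.comp_mk₀_id e]
  have : 𝟙 N = 0 := by ext x; exact Subsingleton.elim _ _
  rw [this]
  simp [restr_zero]

lemma pow_smul_zero {t : ℕ} (e : Abelian.Ext (Q a t) N i) {x : R} (hx : x ∈ a ^ t) :
    x • e = 0 := by
  rw [← Abelian.Ext.mk₀_id_comp e, ← Abelian.Ext.smul_comp, ← Abelian.Ext.mk₀_smul]
  have : x • 𝟙 (Q a t) = 0 := by
    refine ModuleCat.hom_ext (LinearMap.ext fun y => ?_)
    obtain ⟨y, rfl⟩ := Submodule.Quotient.mk_surjective _ y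
    change x • (Submodule.Quotient.mk y : R ⧸ a ^ t) = 0
    rw [← Submodule.Quotient.mk_smul, Submodule.Quotient.mk_eq_zero]
    exact Ideal.mul_mem_right _ _ hx
  rw [this]
  simp

lemma van_smul {x : R} (hx : x ∈ a) (reg : IsSMulRegular N x)
    (h : Van a i (ModuleCat.smulShortComplex N x).X₃) : Van a (i+1) N := by
  have key : ∀ (n t : ℕ) (e : Abelian.Ext (Q a t) N (i+1)), x ^ n • e = 0 →
      ∃ (s : ℕ) (h : t ≤ s), restr a h e = 0 := by
    intro n
    induction n with
    | zero =>
      intro t e he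
      refine ⟨t, le_rfl, ?_⟩
      rw [pow_zero, one_smul] at he
      rw [he, restr_zero]
    | succ n ih =>
      intro t e he
      rw [pow_succ', mul_smul, Abelian.Ext.smul_eq_comp_mk₀] at he
      obtain ⟨c, hc⟩ := Abelian.Ext.covariant_sequence_exact₁ _ reg.smulShortComplex_shortExact
        (x ^ n • e) he rfl
      obtain ⟨s, hs, h0⟩ := h t c
      obtain ⟨u, hu, h1⟩ := ih s (restr a hs e) (by
        rw [← restr_smul, ← hc]
        refine (restr_comp hs c _ _).trans ?_
        rw [h0]
        exact Abelian.Ext.zero_comp (C := ModuleCat.{0} R) (X := Q a s) (n := i)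
          reg.smulShortComplex_shortExact.extClass _ _)
      exact ⟨u, hs.trans hu, by rw [← restr_restr hs hu, h1]⟩
  intro t e
  exact key t t e (pow_smul_zero e (Ideal.pow_mem_pow hx t))

lemma exists_shift (F : Type) [AddCommGroup F] [Module R F] [Module.Finite R F]
    {N : ModuleCat.{0} R} {n : ℕ} (f : (Fin n → R) →ₗ[R] F) (hf : Function.Surjective f)
    (e : Abelian.Ext (ModuleCat.of R F) N (i+1)) :
    ∃ e' : Abelian.Ext (ModuleCat.of R (LinearMap.ker f)) N i,
      (LinearMap.shortExact_shortComplexKer hf).extClass.comp e' (add_comm 1 i) = e := by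
  refine Abelian.Ext.contravariant_sequence_exact₃
    (LinearMap.shortExact_shortComplexKer hf) N e ?_ (add_comm 1 i)
  have : Projective (ModuleCat.of R (Fin n → R)) :=
    (IsProjective.iff_projective _).1 inferInstance
  exact Abelian.Ext.eq_zero_of_projective _

lemma exists_fg [IsNoetherianRing R] (N : ModuleCat.{0} R) (F : Type) [AddCommGroup F]
    [Module R F] [Module.Finite R F] (e : Abelian.Ext (ModuleCat.of R F) N i) :
    ∃ (N' : Submodule R N) (_ : N'.FG) (e' : Abelian.Ext (ModuleCat.of R F) (ModuleCat.of R N') i),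
      e'.comp (Abelian.Ext.mk₀ (ModuleCat.ofHom N'.subtype)) (add_zero i) = e := by
  induction i generalizing F with
  | zero =>
    obtain ⟨f, rfl⟩ := (Abelian.Ext.mk₀_bijective _ _).2 e
    refine ⟨LinearMap.range f.hom, ?_, Abelian.Ext.mk₀ (ModuleCat.ofHom f.hom.rangeRestrict), ?_⟩
    · rw [LinearMap.range_eq_map]
      exact Submodule.FG.map _ Module.Finite.fg_top
    · rw [Abelian.Ext.mk₀_comp_mk₀]
      rfl
  | succ i ih =>
    obtain ⟨n, f, hf⟩ := Module.Finite.exists_fin' R F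
    obtain ⟨e', rfl⟩ := exists_shift F f hf e
    obtain ⟨N', h, e'', rfl⟩ := ih _ e'
    exact ⟨N', h, (LinearMap.shortExact_shortComplexKer hf).extClass.comp e'' (add_comm 1 i),
      Abelian.Ext.comp_assoc_of_third_deg_zero _ _ _ _⟩

lemma van_of_fg [IsNoetherianRing R] (N : ModuleCat.{0} R)
    (h : ∀ N' : Submodule R N, N'.FG → Van a i (ModuleCat.of R N')) : Van a i N := by
  intro t e
  obtain ⟨N', hN', e', rfl⟩ := exists_fg N _ e
  obtain ⟨s, hs, h0⟩ := h N' hN' t e'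
  refine ⟨s, hs, ?_⟩
  rw [restr_comp, h0, Abelian.Ext.zero_comp]

end
end LC

namespace LC
noncomputable section
variable {R : Type} [CommRing R]
variable {a : Ideal R} {i : ℕ} {N N' : ModuleCat.{0} R}

lemma mem_smul_top_sub {F : Type} [AddCommGroup F] [Module R F] (K : Submodule R F) (b : Ideal R)
    (x : F) (hx : x ∈ b • K) (hx' : x ∈ K) : (⟨x, hx'⟩ : K) ∈ (b • ⊤ : Submodule R K) := by
  have h : (b • ⊤ : Submodule R K).map K.subtype = b • K := by
    rw [Submodule.map_smul'', Submodule.map_top, Submodule.range_subtype]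
  rw [← h] at hx
  obtain ⟨y, hy, rfl⟩ := hx
  exact hy

/-- Naturality of the connecting class for a map of kernels. -/
lemma ext_nat {A B A' B' : Type} [AddCommGroup A] [Module R A] [AddCommGroup B] [Module R B]
    [AddCommGroup A'] [Module R A'] [AddCommGroup B'] [Module R B']
    (g : A' →ₗ[R] B') (hg : Function.Surjective g) (f : A →ₗ[R] B) (hf : Function.Surjective f)
    (u : A' →ₗ[R] A) (v : B' →ₗ[R] B) (huv : ∀ x, f (u x) = v (g x))
    (W : Submodule R (LinearMap.ker f))
    (hW : ∀ x (hx : g x = 0), (⟨u x, by simp [huv, hx]⟩ : LinearMap.ker f) ∈ W)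
    (e' : Abelian.Ext (ModuleCat.of R (LinearMap.ker f)) N i)
    (he' : (Abelian.Ext.mk₀ (ModuleCat.ofHom W.subtype)).comp e' (zero_add i) = 0) :
    (Abelian.Ext.mk₀ (ModuleCat.ofHom v)).comp
      ((LinearMap.shortExact_shortComplexKer hf).extClass.comp e' (add_comm 1 i)) (zero_add _)
      = 0 := by
  let w : LinearMap.ker g →ₗ[R] W :=
    { toFun := fun x => ⟨⟨u x.1, by simp [huv]⟩, hW x.1 x.2⟩
      map_add' := fun x y => by ext; simp
      map_smul' := fun r x => by ext; simp }
  let φ : g.shortComplexKer ⟶ f.shortComplexKer :=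
    { τ₁ := ModuleCat.ofHom w ≫ ModuleCat.ofHom W.subtype
      τ₂ := ModuleCat.ofHom u
      τ₃ := ModuleCat.ofHom v
      comm₁₂ := rfl
      comm₂₃ := ModuleCat.hom_ext (LinearMap.ext huv) }
  have h := ShortComplex.ShortExact.extClass_naturality
    (LinearMap.shortExact_shortComplexKer hg) (LinearMap.shortExact_shortComplexKer hf) φ
  have h2 := congr_arg (fun z => z.comp e' (add_comm 1 i)) h
  rw [← Abelian.Ext.comp_assoc _ _ _ (zero_add 1) (add_comm 1 i) (by lia)]
  refine h2.symm.trans ?_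
  simp only [φ]
  rw [Abelian.Ext.comp_assoc_of_second_deg_zero, ← Abelian.Ext.mk₀_comp_mk₀_assoc, he']
  simp

lemma kill [IsNoetherianRing R] {k : ℕ} (hk : ∀ x ∈ a ^ k, ∀ y : N, x • y = 0)
    (F : Type) [AddCommGroup F] [Module R F] [Module.Finite R F]
    (e : Abelian.Ext (ModuleCat.of R F) N i) :
    ∃ s, (Abelian.Ext.mk₀ (ModuleCat.ofHom (a ^ s • ⊤ : Submodule R F).subtype)).comp e
      (zero_add i) = 0 := by
  induction i generalizing F with
  | zero =>
    obtain ⟨f, rfl⟩ := (Abelian.Ext.mk₀_bijective _ _).2 e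
    refine ⟨k, ?_⟩
    rw [Abelian.Ext.mk₀_comp_mk₀, Abelian.Ext.mk₀_eq_zero_iff]
    refine ModuleCat.hom_ext (LinearMap.ext fun y => ?_)
    obtain ⟨y, hy⟩ := y
    change f.hom y = 0
    refine Submodule.smul_induction_on hy ?_ ?_
    · intro r hr n _
      rw [map_smul]
      exact hk r hr _
    · intro x y hx hy
      rw [map_add, hx, hy, add_zero]
  | succ i ih =>
    obtain ⟨n, f, hf⟩ := Module.Finite.exists_fin' R F
    obtain ⟨e', rfl⟩ := exists_shift F f hf e
    obtain ⟨s, hs⟩ := ih _ e'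
    obtain ⟨c, hc⟩ := Ideal.exists_pow_inf_eq_pow_smul a (LinearMap.ker f)
    have hmap : (a ^ (c + s) • ⊤ : Submodule R (Fin n → R)).map f = a ^ (c + s) • ⊤ := by
      rw [Submodule.map_smul'', Submodule.map_top, LinearMap.range_eq_top.2 hf]
    refine ⟨c + s, ?_⟩
    refine ext_nat (f.restrict (p := a ^ (c + s) • ⊤) (q := a ^ (c + s) • ⊤) ?_) ?_ f hf
      (Submodule.subtype _) _ (fun x => rfl) _ ?_ e' hs
    · intro x hx
      rw [← hmap]
      exact Submodule.mem_map_of_mem hx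
    · rintro ⟨y, hy⟩
      have hy' := hy
      rw [← hmap] at hy'
      obtain ⟨x, hx, rfl⟩ := hy'
      exact ⟨⟨x, hx⟩, rfl⟩
    · rintro ⟨x, hx⟩ h0
      have h0' : f x = 0 := congr_arg Subtype.val h0
      apply mem_smul_top_sub
      have : x ∈ a ^ (c + s) • ⊤ ⊓ LinearMap.ker f := ⟨hx, h0'⟩
      rw [hc _ (by lia), Nat.add_sub_cancel_left] at this
      exact Submodule.smul_mono le_rfl inf_le_right this

lemma van_of_torsion [IsNoetherianRing R] {k : ℕ} (hk : ∀ x ∈ a ^ k, ∀ y : N, x • y = 0) :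
    Van a (i+1) N := by
  intro t e
  have hf := Submodule.mkQ_surjective (a ^ t)
  obtain ⟨e', rfl⟩ : ∃ e' : Abelian.Ext (ModuleCat.of R (LinearMap.ker (a ^ t).mkQ)) N i,
      (LinearMap.shortExact_shortComplexKer hf).extClass.comp e' (add_comm 1 i) = e := by
    refine Abelian.Ext.contravariant_sequence_exact₃
      (LinearMap.shortExact_shortComplexKer hf) N e ?_ (add_comm 1 i)
    have : Projective (ModuleCat.of R R) :=
      (IsProjective.iff_projective _).1 inferInstance
    exact Abelian.Ext.eq_zero_of_projective _
  obtain ⟨s, hs⟩ := kill hk _ e'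
  refine ⟨t + s, by lia, ?_⟩
  refine ext_nat (Submodule.mkQ (a ^ (t + s))) (Submodule.mkQ_surjective _) _ hf LinearMap.id
      _ (fun x => rfl) _ ?_ e' hs
  intro x hx
  apply mem_smul_top_sub
  rw [Submodule.ker_mkQ, smul_eq_mul, ← pow_add, add_comm s t]
  rwa [Submodule.mkQ_apply, Submodule.Quotient.mk_eq_zero] at hx

lemma van_of_primes [IsNoetherianRing R] (N : Type) [AddCommGroup N] [Module R N]
    [hN : Module.Finite R N]
    (h : ∀ q : Ideal R, q.IsPrime → Module.annihilator R N ≤ q → Van a i (ModuleCat.of R (R ⧸ q))) :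
    Van a i (ModuleCat.of R N) := by
  induction hN using IsNoetherianRing.induction_on_isQuotientEquivQuotientPrime R with
  | subsingleton N => exact van_of_subsingleton
  | quotient N p f =>
    refine van_iso f.toModuleIso (h _ p.2 ?_)
    rw [f.annihilator_eq, Ideal.annihilator_quotient]
  | exact N₁ N₂ N₃ f g hf hg hfg h₁ h₃ =>
    have hS := ModuleCat.shortComplex_shortExact
      (ModuleCat.shortComplexOfCompEqZero f g hfg.linearMap_comp_eq_zero) hfg hf hg
    exact van_mid hS
      (h₁ fun q hq hle => h q hq ((f.annihilator_le_of_injective hf).trans hle))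
      (h₃ fun q hq hle => h q hq ((g.annihilator_le_of_surjective hg).trans hle))

end
end LC

namespace LC
noncomputable section
variable {R : Type} [CommRing R]
variable {a : Ideal R} {i : ℕ} {N N' : ModuleCat.{0} R}

lemma dim_drop {q q' : Ideal R} [q.IsPrime] (h : q < q') :
    ringKrullDim (R ⧸ q') + 1 ≤ ringKrullDim (R ⧸ q) := by
  obtain ⟨hle, x, hx, hxq⟩ := SetLike.lt_iff_le_and_exists.1 h
  have h0 : Ideal.Quotient.mk q x ∈ nonZeroDivisors (R ⧸ q) := by
    rw [mem_nonZeroDivisors_iff_ne_zero, Ne, Ideal.Quotient.eq_zero_iff_mem]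
    exact hxq
  refine le_trans ?_ (ringKrullDim_quotient_succ_le_of_nonZeroDivisor h0)
  gcongr
  refine ringKrullDim_le_of_surjective
    (Ideal.Quotient.lift (Ideal.span {Ideal.Quotient.mk q x}) (Ideal.Quotient.factor hle) ?_) ?_
  · intro y hy
    have : Ideal.span {Ideal.Quotient.mk q x} ≤ RingHom.ker (Ideal.Quotient.factor hle) := by
      rw [Ideal.span_singleton_le_iff_mem, RingHom.mem_ker, Ideal.Quotient.factor_mk,
        Ideal.Quotient.eq_zero_iff_mem]
      exact hx
    exact this hy
  · exact Ideal.Quotient.lift_surjective_of_surjective _ _ (Ideal.Quotient.factor_surjective hle)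

open scoped Pointwise in
lemma van_dim [IsNoetherianRing R] (i : ℕ) : ∀ q : Ideal R, q.IsPrime →
    ringKrullDim (R ⧸ q) < (i : WithBot ℕ∞) → Van a i (ModuleCat.of R (R ⧸ q)) := by
  induction i with
  | zero =>
    intro q hq h
    exact absurd (ringKrullDim_nonneg_of_nontrivial (R := R ⧸ q)) (not_le.2 h)
  | succ i ih =>
    intro q hq h
    by_cases haq : a ≤ q
    · refine van_of_torsion (k := 1) fun x hx y => ?_
      obtain ⟨y, rfl⟩ := Ideal.Quotient.mk_surjective y
      rw [pow_one] at hx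
      change Ideal.Quotient.mk q (x * y) = 0
      rw [Ideal.Quotient.eq_zero_iff_mem]
      exact Ideal.mul_mem_right _ _ (haq hx)
    · obtain ⟨x, hxa, hxq⟩ := SetLike.not_le_iff_exists.1 haq
      have reg : IsSMulRegular (ModuleCat.of R (R ⧸ q)) x := by
        rw [isSMulRegular_iff_right_eq_zero_of_smul]
        intro y hy
        obtain ⟨y, rfl⟩ := Ideal.Quotient.mk_surjective y
        replace hy : Ideal.Quotient.mk q (x * y) = 0 := hy
        rw [Ideal.Quotient.eq_zero_iff_mem] at hy ⊢
        exact (hq.mem_or_mem hy).resolve_left hxq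
      refine van_smul hxa reg ?_
      refine van_of_primes ((R ⧸ q) ⧸ (x • (⊤ : Submodule R (R ⧸ q)))) fun q' hq' hle => ih q' hq' ?_
      have hlt : q < q' := by
        refine SetLike.lt_iff_le_and_exists.2 ⟨fun y hy => hle ?_, x, hle ?_, hxq⟩
        · rw [Module.mem_annihilator]
          intro z
          obtain ⟨z, rfl⟩ := Submodule.Quotient.mk_surjective _ z
          obtain ⟨z, rfl⟩ := Ideal.Quotient.mk_surjective z
          rw [← Submodule.Quotient.mk_smul]
          have : y • Ideal.Quotient.mk q z = 0 := by
            change Ideal.Quotient.mk q (y * z) = 0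
            rw [Ideal.Quotient.eq_zero_iff_mem]
            exact Ideal.mul_mem_right _ _ hy
          rw [this, Submodule.Quotient.mk_zero]
        · rw [Module.mem_annihilator]
          intro z
          obtain ⟨z, rfl⟩ := Submodule.Quotient.mk_surjective _ z
          rw [← Submodule.Quotient.mk_smul, Submodule.Quotient.mk_eq_zero]
          exact Submodule.smul_mem_pointwise_smul _ _ _ trivial
      have h1 := (dim_drop hlt).trans_lt h
      push_cast at h1
      exact lt_of_add_lt_add_right h1

lemma van_all [IsNoetherianRing R] {d : ℕ} (hd : ringKrullDim R = (d : WithBot ℕ∞)) (hi : d < i)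
    (N : ModuleCat.{0} R) : Van a i N := by
  refine van_of_fg N fun N' hN' => ?_
  have : Module.Finite R N' := Module.Finite.iff_fg.2 hN'
  refine van_of_primes _ fun q hq _ => van_dim i q hq ?_
  refine lt_of_le_of_lt (ringKrullDim_quotient_le q) ?_
  rw [hd]
  exact_mod_cast hi

/-- Postcomposition as a linear map. -/
def postc {X Y Z : ModuleCat.{0} R} (e : Abelian.Ext X Y i) : (Y ⟶ Z) →ₗ[R] Abelian.Ext X Z i where
  toFun g := e.comp (Abelian.Ext.mk₀ g) (add_zero i)
  map_add' f g := by rw [Abelian.Ext.mk₀_add, Abelian.Ext.comp_add]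
  map_smul' r f := by rw [Abelian.Ext.mk₀_smul, Abelian.Ext.comp_smul]; rfl

lemma smul_top_eq [IsNoetherianRing R] (p : Ideal R) (M : ModuleCat.{0} R)
    (h1 : ∀ N, Van a (i+1) N)
    (h0 : Van a i (ModuleCat.of R (M ⧸ (p • ⊤ : Submodule R M)))) :
    (p • ⊤ : Submodule R ((localCohomology a i).obj M)) = ⊤ := by
  rw [eq_top_iff]
  rintro h -
  obtain ⟨t, e, rfl⟩ := iota_surj a i M h
  obtain ⟨n, x, hx⟩ := Submodule.fg_iff_exists_fin_generating_family.1 (IsNoetherian.noetherian p)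
  let f : (Fin n → M) →ₗ[R] M := ∑ k, x k • LinearMap.proj k
  have hfa (v : Fin n → M) : f v = ∑ k, x k • v k := by simp [f]
  let K : Submodule R M := LinearMap.ker (Submodule.mkQ (p • ⊤ : Submodule R M))
  have hK : K = p • ⊤ := Submodule.ker_mkQ _
  have hxp (k) : x k ∈ p := by rw [← hx]; exact Submodule.subset_span ⟨k, rfl⟩
  have hfK (v : Fin n → M) : f v ∈ K := by
    rw [hK, hfa]
    exact Submodule.sum_mem _ fun k _ => Submodule.smul_mem_smul (hxp k) trivial
  let f' : (Fin n → M) →ₗ[R] K := f.codRestrict K hfK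
  have hf' : Function.Surjective f' := by
    rintro ⟨y, hy⟩
    have : p • ⊤ ≤ LinearMap.range f := by
      rw [Submodule.smul_le]
      intro r hr m _
      rw [← hx] at hr
      obtain ⟨c, rfl⟩ := (Submodule.mem_span_range_iff_exists_fun R).1 hr
      refine ⟨fun k => c k • m, ?_⟩
      rw [hfa, Finset.sum_smul]
      refine Finset.sum_congr rfl fun k _ => ?_
      rw [smul_smul, smul_eq_mul, mul_comm]
    obtain ⟨v, hv⟩ := this (hK ▸ hy)
    exact ⟨v, Subtype.ext hv⟩
  have hq := Submodule.mkQ_surjective (p • ⊤ : Submodule R M)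
  obtain ⟨s, hs, h2⟩ := h0 t (e.comp (Abelian.Ext.mk₀ (ModuleCat.ofHom (Submodule.mkQ _))) (add_zero i))
  rw [restr_comp] at h2
  obtain ⟨e1, he1⟩ := Abelian.Ext.covariant_sequence_exact₂ _
    (LinearMap.shortExact_shortComplexKer hq) (restr a hs e) h2
  obtain ⟨u, hu, h3⟩ := h1 _ s (e1.comp (LinearMap.shortExact_shortComplexKer hf').extClass rfl)
  rw [restr_comp] at h3
  obtain ⟨e2, he2⟩ := Abelian.Ext.covariant_sequence_exact₃ _
    (LinearMap.shortExact_shortComplexKer hf') (restr a hu e1) rfl h3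
  have key : restr a (hs.trans hu) e = ∑ k, x k • postc e2 (ModuleCat.ofHom (LinearMap.proj k)) := by
    rw [← restr_restr hs hu, ← he1, restr_comp]
    refine (congr_arg (fun z => z.comp (Abelian.Ext.mk₀ (ModuleCat.ofHom K.subtype)) (add_zero i))
      he2.symm).trans ?_
    have hf : (ModuleCat.ofHom f' ≫ ModuleCat.ofHom K.subtype : ModuleCat.of R (Fin n → M) ⟶ M) =
        ∑ k, x k • ModuleCat.ofHom (LinearMap.proj k) := by
      refine ModuleCat.hom_ext (LinearMap.ext fun v => ?_)
      simp only [ModuleCat.hom_sum, LinearMap.sum_apply, ModuleCat.hom_smul, LinearMap.smul_apply]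
      exact hfa v
    change (e2.comp (Abelian.Ext.mk₀ (ModuleCat.ofHom f')) (add_zero i)).comp
      (Abelian.Ext.mk₀ (ModuleCat.ofHom K.subtype)) (add_zero i) = _
    rw [Abelian.Ext.comp_assoc_of_third_deg_zero, Abelian.Ext.mk₀_comp_mk₀, hf]
    change postc e2 _ = _
    rw [map_sum]
    simp only [map_smul]
  rw [← iota_restr a i M (hs.trans hu), key, map_sum]
  refine Submodule.sum_mem _ fun k _ => ?_
  rw [map_smul]
  exact Submodule.smul_mem_smul (hxp k) trivial

lemma att_le (H : Type) [AddCommGroup H] [Module R H] (p : Ideal R) [hp : p.IsPrime]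
    (B : Submodule R H) (hB : p = Module.annihilator R (H ⧸ B)) : (p • ⊤ : Submodule R H) ≠ ⊤ := by
  intro h
  apply hp.ne_top
  have : (⊤ : Submodule R H) ≤ B := by
    rw [← h, Submodule.smul_le]
    intro r hr m _
    rw [hB, Module.mem_annihilator] at hr
    rw [← Submodule.Quotient.mk_eq_zero, Submodule.Quotient.mk_smul]
    exact hr _
  rw [hB, Module.annihilator_eq_top_iff]
  refine subsingleton_of_forall_eq 0 fun z => ?_
  obtain ⟨z, rfl⟩ := Submodule.Quotient.mk_surjective _ z
  exact (Submodule.Quotient.mk_eq_zero _).2 (this trivial)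

end
end LC

end

theorem stmt19 {R : Type} [CommRing R] [IsNoetherianRing R]
    (a : Ideal R) (M : ModuleCat R) (hM : Nontrivial M)
    (d : ℕ)
    (hdimM : Order.krullDim (Module.support R M) = (d : WithBot (WithTop ℕ)))
    (hdimR : ringKrullDim R = (d : WithBot (WithTop ℕ))) :
    attachedPrimes R ((localCohomology a d).obj M) ⊆
      {p | p ∈ associatedPrimes R M ∧ HasCD a (ModuleCat.of R (R ⧸ p)) d} := by
  rintro p ⟨hp, B, hB⟩
  have hvan : ∀ i, d < i → ∀ N, LC.Van a i N := fun i hi N => LC.van_all hdimR hi N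
  have h1 : ¬ LC.Van a d (ModuleCat.of R (M ⧸ (p • ⊤ : Submodule R M))) := fun h =>
    LC.att_le _ p B hB (LC.smul_top_eq p M (hvan _ (Nat.lt_succ_self d)) h)
  obtain ⟨N', hN', h2⟩ : ∃ N' : Submodule R (M ⧸ (p • ⊤ : Submodule R M)), N'.FG ∧
      ¬ LC.Van a d (ModuleCat.of R N') := by
    by_contra! hc
    exact h1 (LC.van_of_fg _ hc)
  have hfin : Module.Finite R N' := Module.Finite.iff_fg.2 hN'
  obtain ⟨q, hq, hNq, h3⟩ : ∃ q : Ideal R, q.IsPrime ∧ Module.annihilator R N' ≤ q ∧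
      ¬ LC.Van a d (ModuleCat.of R (R ⧸ q)) := by
    by_contra! hc
    exact h2 (LC.van_of_primes _ hc)
  have h4 : (d : WithBot ℕ∞) ≤ ringKrullDim (R ⧸ q) := by
    by_contra! hc
    exact h3 (LC.van_dim d q hq hc)
  have hmin : ∀ p' : Ideal R, p'.IsPrime → ¬ p' < q := by
    intro p' hp' hlt
    have h5 := (LC.dim_drop hlt).trans (ringKrullDim_quotient_le p')
    rw [hdimR] at h5
    have h6 : ((d + 1 : ℕ) : WithBot ℕ∞) ≤ (d : ℕ) := by
      push_cast
      exact (add_le_add_left h4 1).trans h5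
    have : d + 1 ≤ d := by exact_mod_cast h6
    lia
  have hpN : p ≤ Module.annihilator R N' := by
    intro r hr
    rw [Module.mem_annihilator]
    rintro ⟨z, hz⟩
    apply Subtype.ext
    change r • z = 0
    obtain ⟨m, rfl⟩ := Submodule.Quotient.mk_surjective _ z
    rw [← Submodule.Quotient.mk_smul, Submodule.Quotient.mk_eq_zero]
    exact Submodule.smul_mem_smul hr trivial
  obtain rfl : p = q := by
    by_contra hne
    exact hmin p hp (lt_of_le_of_ne (hpN.trans hNq) hne)
  refine ⟨?_, ?_, fun i hi => (LC.van_iff a i _).2 (hvan i hi _)⟩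
  · have hsup : (⟨p, hp⟩ : PrimeSpectrum R) ∈ Module.support R N' :=
      Module.mem_support_iff_of_finite.2 hNq
    obtain ⟨⟨z, hz⟩, hzp⟩ := Module.mem_support_iff_exists_annihilator.1 hsup
    obtain ⟨m, rfl⟩ := Submodule.Quotient.mk_surjective _ z
    have hmp : Module.annihilator R (R ∙ m) ≤ p := by
      intro r hr
      apply hzp
      change r ∈ Submodule.annihilator _ at hr
      rw [Submodule.mem_annihilator_span_singleton] at hr ⊢
      apply Subtype.ext
      change r • Submodule.Quotient.mk m = 0
      rw [← Submodule.Quotient.mk_smul, hr, Submodule.Quotient.mk_zero]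
    have hpm : p ∈ (Module.annihilator R (R ∙ m)).minimalPrimes := by
      refine ⟨⟨hp, hmp⟩, fun q hq hle => ?_⟩
      by_contra hc
      exact hmin q hq.1 (lt_of_le_not_ge hle hc)
    exact associatedPrimes.subset_of_injective (R ∙ m).injective_subtype
      (Module.associatedPrimes.minimalPrimes_annihilator_subset_associatedPrimes R (R ∙ m) hpm)
  · rw [← not_subsingleton_iff_nontrivial, LC.van_iff]
    exact h3
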